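/- For all symmetric positive definite n×n matrices p, q, r, the geodesic midpoint map contracts the vectorial distance by a factor 1/2: d⃗(r #_{1/2} p, r #_{1/2} q) ⪯ (1/2) d⃗(p,q), where ⪯ is the partial order comparing partial sums of components (with equality of total sums relaxed to inequality in each partial sum and equality for the full sum). -/

import Mathlib

open Matrix

noncomputable section

variable {n : ℕ}

/-- The `t`-th power of a symmetric matrix, defined via the spectral decomposition
(junk value if the matrix is not symmetric). -/
noncomputable def mpow (A : Matrix (Fin n) (Fin n) ℝ) (t : ℝ) : Matrix (Fin n) (Fin n) ℝ :=
  if h : A.IsHermitian then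
    (h.eigenvectorUnitary : Matrix (Fin n) (Fin n) ℝ) *
      Matrix.diagonal (fun i => (h.eigenvalues i) ^ t) *
      (star (h.eigenvectorUnitary : Matrix (Fin n) (Fin n) ℝ))
  else A

/-- Eigenvalues of a symmetric matrix, listed in nonincreasing order
(junk value `0` if the matrix is not symmetric). -/
noncomputable def eigsDesc (A : Matrix (Fin n) (Fin n) ℝ) : Fin n → ℝ :=
  if h : A.IsHermitian then fun i => h.eigenvalues (Tuple.sort h.eigenvalues i.rev) else 0

/-- Singular values of a square real matrix, in nonincreasing order. -/
noncomputable def svals (g : Matrix (Fin n) (Fin n) ℝ) : Fin n → ℝ :=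
  fun i => Real.sqrt (eigsDesc (gᵀ * g) i)

/-- The vector `σ⃗(g)` of base-2 logarithms of the singular values of `g`,
in nonincreasing order. -/
noncomputable def sigmaVec (g : Matrix (Fin n) (Fin n) ℝ) : Fin n → ℝ :=
  fun i => Real.logb 2 (svals g i)

/-- The vectorial distance `d⃗(p,q) = 2 σ⃗(p^{-1/2} q^{1/2})`. -/
noncomputable def vecd (p q : Matrix (Fin n) (Fin n) ℝ) : Fin n → ℝ :=
  fun i => 2 * sigmaVec (mpow p (-(1/2)) * mpow q (1/2)) i

/-- Partial sum of the first `k` components of a vector in `ℝⁿ`. -/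
noncomputable def psum (ξ : Fin n → ℝ) (k : ℕ) : ℝ :=
  ∑ i ∈ Finset.univ.filter (fun i : Fin n => (i : ℕ) < k), ξ i

/-- The majorization-type partial order `⪯` on `ℝⁿ`: all partial sums are compared,
with equality of the total sums. -/
def maj (ξ η : Fin n → ℝ) : Prop :=
  (∀ k : ℕ, k < n → psum ξ k ≤ psum η k) ∧ psum ξ n = psum η n

/-- The geodesic `p #_t q = p^{1/2} (p^{-1/2} q p^{-1/2})^t p^{1/2}` in the trace metric
on positive definite matrices. -/
noncomputable def geo (p q : Matrix (Fin n) (Fin n) ℝ) (t : ℝ) : Matrix (Fin n) (Fin n) ℝ :=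
  mpow p (1/2) * mpow (mpow p (-(1/2)) * q * mpow p (-(1/2))) t * mpow p (1/2)

/-- The Riemannian (trace-metric) distance on positive definite matrices, expressed as the
Euclidean norm of the vector of base-2 logarithms of the eigenvalues of `p^{-1/2} q p^{-1/2}`. -/
noncomputable def rdist (p q : Matrix (Fin n) (Fin n) ℝ) : ℝ :=
  Real.sqrt (∑ i : Fin n,
    (Real.logb 2 (eigsDesc (mpow p (-(1/2)) * q * mpow p (-(1/2))) i)) ^ 2)


lemma mpow_spec {n : ℕ} {A : Matrix (Fin n) (Fin n) ℝ} (hA : A.PosDef) :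
    (∀ t, (mpow A t)ᵀ = mpow A t) ∧ (∀ s t, mpow A s * mpow A t = mpow A (s + t)) ∧
    mpow A 0 = 1 ∧ mpow A 1 = A := by
  have h := hA.1
  have hU : star (h.eigenvectorUnitary : Matrix (Fin n) (Fin n) ℝ) *
      (h.eigenvectorUnitary : Matrix (Fin n) (Fin n) ℝ) = 1 := Unitary.coe_star_mul_self _
  have hU' : (h.eigenvectorUnitary : Matrix (Fin n) (Fin n) ℝ) *
      star (h.eigenvectorUnitary : Matrix (Fin n) (Fin n) ℝ) = 1 := Unitary.coe_mul_star_self _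
  have key : ∀ t, mpow A t = (h.eigenvectorUnitary : Matrix (Fin n) (Fin n) ℝ) *
      Matrix.diagonal (fun i => (h.eigenvalues i) ^ t) *
      (star (h.eigenvectorUnitary : Matrix (Fin n) (Fin n) ℝ)) := by
    intro t; rw [mpow, dif_pos h]
  have hspec := h.spectral_theorem
  rw [Unitary.conjStarAlgAut_apply] at hspec
  refine ⟨?_, ?_, ?_, ?_⟩
  · intro t
    rw [key]
    simp only [Matrix.star_eq_conjTranspose, Matrix.conjTranspose_eq_transpose_of_trivial,
      Matrix.transpose_mul, Matrix.transpose_transpose, Matrix.diagonal_transpose, Matrix.mul_assoc]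
  · intro s t
    rw [key, key, key]
    generalize (h.eigenvectorUnitary : Matrix (Fin n) (Fin n) ℝ) = U at hU
    have : diagonal (fun i => (h.eigenvalues i) ^ (s + t)) =
        diagonal (fun i => (h.eigenvalues i) ^ s) * diagonal (fun i => (h.eigenvalues i) ^ t) := by
      rw [Matrix.diagonal_mul_diagonal]
      congr 1; funext i
      exact Real.rpow_add (hA.eigenvalues_pos i) s t
    rw [this]
    simp only [Matrix.mul_assoc]
    rw [← Matrix.mul_assoc (star U) U, hU, Matrix.one_mul]
  · rw [key]; simp [hU']
  · rw [key]
    conv_rhs => rw [hspec]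
    simp

lemma mpow_posDef {n : ℕ} {A : Matrix (Fin n) (Fin n) ℝ} (hA : A.PosDef) (t : ℝ) :
    (mpow A t).PosDef := by
  obtain ⟨h1, h2, h3, h4⟩ := mpow_spec hA
  have e : mpow A t = (mpow A (t/2))ᴴ * mpow A (t/2) := by
    rw [Matrix.conjTranspose_eq_transpose_of_trivial, h1, h2]; congr 1; ring
  rw [e]
  apply Matrix.PosDef.conjTranspose_mul_self
  apply Matrix.mulVec_injective_of_isUnit
  have : mpow A (-(t/2)) * mpow A (t/2) = 1 := by rw [h2, ← h3]; congr 1; ring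
  exact IsUnit.of_mul_eq_one_right _ this

lemma congr_posDef {n : ℕ} {A B : Matrix (Fin n) (Fin n) ℝ} (hA : A.PosDef) (hB : Bᵀ = B)
    (hu : IsUnit B) : (B * A * B).PosDef := by
  have := hA.conjTranspose_mul_mul_same (B := B) (Matrix.mulVec_injective_of_isUnit hu)
  rwa [Matrix.conjTranspose_eq_transpose_of_trivial, hB] at this

lemma eigsDesc_spec {n : ℕ} {H : Matrix (Fin n) (Fin n) ℝ} (h : H.IsHermitian) :
    Antitone (eigsDesc H) ∧ ∃ U : Matrix (Fin n) (Fin n) ℝ, Uᵀ * U = 1 ∧ U * Uᵀ = 1 ∧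
      H = U * diagonal (eigsDesc H) * Uᵀ := by
  have hd : eigsDesc H = fun i => h.eigenvalues (Tuple.sort h.eigenvalues i.rev) := by
    rw [eigsDesc, dif_pos h]
  have hU : star (h.eigenvectorUnitary : Matrix (Fin n) (Fin n) ℝ) *
      (h.eigenvectorUnitary : Matrix (Fin n) (Fin n) ℝ) = 1 := Unitary.coe_star_mul_self _
  have hspec := h.spectral_theorem
  rw [Unitary.conjStarAlgAut_apply] at hspec
  constructor
  · rw [hd]
    intro i j hij
    exact Tuple.monotone_sort h.eigenvalues (Fin.rev_le_rev.mpr hij)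
  · let e : Fin n ≃ Fin n := Fin.revPerm.trans (Tuple.sort h.eigenvalues)
    let V : Matrix (Fin n) (Fin n) ℝ := h.eigenvectorUnitary
    have hV : Vᵀ * V = 1 := by
      rw [← hU, Matrix.star_eq_conjTranspose, Matrix.conjTranspose_eq_transpose_of_trivial]
    have h1 : (V.submatrix id e)ᵀ * V.submatrix id e = 1 := by
      rw [Matrix.transpose_submatrix,
        ← Matrix.submatrix_mul _ _ _ _ _ Function.bijective_id, hV]
      exact Matrix.submatrix_one_equiv e
    refine ⟨V.submatrix id e, h1, mul_eq_one_comm.mp h1, ?_⟩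
    have h2 : diagonal (eigsDesc H) = (diagonal h.eigenvalues).submatrix e e := by
      rw [Matrix.submatrix_diagonal_equiv, hd]; rfl
    rw [h2, Matrix.transpose_submatrix, ← Matrix.submatrix_mul _ _ _ _ _ e.bijective,
      ← Matrix.submatrix_mul _ _ _ _ _ e.bijective, Matrix.submatrix_id_id]
    conv_lhs => rw [hspec]
    rw [Matrix.star_eq_conjTranspose, Matrix.conjTranspose_eq_transpose_of_trivial]
    rfl

lemma eigsDesc_pos {n : ℕ} {H : Matrix (Fin n) (Fin n) ℝ} (h : H.PosDef) (i : Fin n) :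
    0 < eigsDesc H i := by
  rw [eigsDesc, dif_pos h.1]
  exact h.eigenvalues_pos _

/-- a symmetrized Cauchy-Binet formula -/
lemma cauchy_binet {n k : ℕ} (V : Matrix (Fin n) (Fin k) ℝ) (d : Fin n → ℝ) :
    (k.factorial : ℝ) * (Vᵀ * diagonal d * V).det =
      ∑ f : Fin k → Fin n, (∏ i, d (f i)) * (V.submatrix f id).det ^ 2 := by
  have h1 : (Vᵀ * diagonal d * V).det =
      ∑ f : Fin k → Fin n, (∏ i, d (f i)) * ((∏ i, V (f i) i) * (V.submatrix f id).det) := by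
    have : Vᵀ * diagonal d * V = fun i => ∑ j, (V j i * d j) • V j := by
      ext i l
      rw [Matrix.mul_apply]
      simp [Finset.sum_apply, Matrix.mul_diagonal]
    rw [this]
    have h2 := (Matrix.detRowAlternating (R := ℝ) (n := Fin k)).toMultilinearMap.map_sum
      (fun i (j : Fin n) => (V j i * d j) • V j)
    refine h2.trans (Finset.sum_congr rfl fun f _ => ?_)
    have h3 := (Matrix.detRowAlternating (R := ℝ) (n := Fin k)).toMultilinearMap.map_smul_univ
      (fun i => V (f i) i * d (f i)) (fun i => V (f i))
    refine h3.trans ?_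
    rw [Finset.prod_mul_distrib, smul_eq_mul]
    have : (Matrix.detRowAlternating (R := ℝ) (n := Fin k)).toMultilinearMap (fun i => V (f i))
      = (V.submatrix f id).det := rfl
    rw [this]; ring
  have h2 : ∀ σ : Equiv.Perm (Fin k), (Vᵀ * diagonal d * V).det =
      ∑ f : Fin k → Fin n, (∏ i, d (f i)) * ((((Equiv.Perm.sign σ : ℤ) : ℝ) * 
        ∏ i, V (f (σ i)) i) * (V.submatrix f id).det) := by
    intro σ
    rw [h1, ← Equiv.sum_comp (Equiv.arrowCongr σ.symm (Equiv.refl (Fin n)))]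
    refine Finset.sum_congr rfl fun f _ => ?_
    have e : (Equiv.arrowCongr σ.symm (Equiv.refl (Fin n))) f = fun i => f (σ i) := by
      funext i; simp [Equiv.arrowCongr]
    rw [e]
    have e2 : (V.submatrix (fun i => f (σ i)) id).det =
        ((Equiv.Perm.sign σ : ℤ) : ℝ) * (V.submatrix f id).det := by
      have := Matrix.det_permute σ (V.submatrix f id)
      rw [← this]; rfl
    rw [e2, Equiv.prod_comp σ (fun i => d (f i))]
    ring
  have h3 : (k.factorial : ℝ) * (Vᵀ * diagonal d * V).det =
      ∑ _σ : Equiv.Perm (Fin k), (Vᵀ * diagonal d * V).det := by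
    simp [Fintype.card_perm]
  rw [h3, Finset.sum_congr rfl fun σ _ => h2 σ, Finset.sum_comm]
  refine Finset.sum_congr rfl fun f _ => ?_
  rw [← Finset.mul_sum, ← Finset.sum_mul, pow_two]
  congr 2
  rw [Matrix.det_apply']
  rfl

lemma prod_le_top {n k : ℕ} (hk : k ≤ n) (d : Fin n → ℝ) (hd : Antitone d) (hpos : ∀ i, 0 < d i)
    (f : Fin k → Fin n) (hf : Function.Injective f) :
    ∏ i, d (f i) ≤ ∏ i, d (Fin.castLE hk i) := by
  classical
  let S : Finset (Fin n) := Finset.univ.image f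
  have hS : S.card = k := by
    rw [Finset.card_image_of_injective _ hf]; simp
  have e1 : ∏ i, d (f i) = ∏ x ∈ S, d x := by
    rw [Finset.prod_image (fun a _ b _ h => hf h)]
  have e2 : ∏ x ∈ S, d x = ∏ i, d (S.orderEmbOfFin hS i) := by
    conv_lhs => rw [← Finset.image_orderEmbOfFin_univ S hS]
    rw [Finset.prod_image (fun a _ b _ h => (S.orderEmbOfFin hS).injective h)]
  rw [e1, e2]
  refine Finset.prod_le_prod (fun i _ => (hpos _).le) fun i _ => hd ?_
  have hm : StrictMono (fun i => S.orderEmbOfFin hS i) := (S.orderEmbOfFin hS).strictMono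
  have : ∀ m : ℕ, ∀ hm' : m < k, m ≤ (S.orderEmbOfFin hS ⟨m, hm'⟩ : ℕ) := by
    intro m
    induction m with
    | zero => intro _; exact Nat.zero_le _
    | succ m ih =>
      intro hm'
      have a := ih (by omega)
      have b : S.orderEmbOfFin hS ⟨m, by omega⟩ < S.orderEmbOfFin hS ⟨m+1, hm'⟩ :=
        hm (by simp [Fin.lt_def])
      have := Fin.lt_def.mp b
      omega
  exact Fin.le_def.mpr (this i i.2)

lemma det_le_top {n k : ℕ} (hk : k ≤ n) {H : Matrix (Fin n) (Fin n) ℝ} (hH : H.PosDef)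
    (V : Matrix (Fin n) (Fin k) ℝ) :
    (Vᵀ * H * V).det ≤ (∏ i, eigsDesc H (Fin.castLE hk i)) * (Vᵀ * V).det := by
  obtain ⟨ha, U, hU, hU', hs⟩ := eigsDesc_spec hH.1
  have hp := eigsDesc_pos hH
  set d := eigsDesc H
  have e1 : Vᵀ * H * V = (Uᵀ * V)ᵀ * diagonal d * (Uᵀ * V) := by
    rw [hs]; simp [Matrix.transpose_mul, Matrix.mul_assoc]
  have e2 : Vᵀ * V = (Uᵀ * V)ᵀ * (diagonal (fun _ => (1:ℝ)) : Matrix (Fin n) (Fin n) ℝ) *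
      (Uᵀ * V) := by
    have : (diagonal (fun _ => (1:ℝ)) : Matrix (Fin n) (Fin n) ℝ) = 1 := Matrix.diagonal_one
    rw [this, Matrix.mul_one, Matrix.transpose_mul, Matrix.transpose_transpose, Matrix.mul_assoc,
      ← Matrix.mul_assoc U, hU', Matrix.one_mul]
  rw [e1, e2]
  generalize Uᵀ * V = W
  have hf : (0:ℝ) < k.factorial := by exact_mod_cast k.factorial_pos
  refine le_of_mul_le_mul_left ?_ hf
  rw [mul_left_comm, cauchy_binet, cauchy_binet, Finset.mul_sum]
  refine Finset.sum_le_sum fun f _ => ?_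
  by_cases hinj : Function.Injective f
  · simp only [Finset.prod_const_one, one_mul]
    exact mul_le_mul_of_nonneg_right (prod_le_top hk d ha hp f hinj) (sq_nonneg _)
  · have : (W.submatrix f id).det = 0 := by
      rw [Function.Injective] at hinj
      push Not at hinj
      obtain ⟨a, b, hab, hne⟩ := hinj
      exact Matrix.det_zero_of_row_eq hne (by funext j; simp [hab])
    simp [this]

/-- Weyl-type inequality -/
lemma weyl {n k : ℕ} (hk : k ≤ n) (G X O H : Matrix (Fin n) (Fin n) ℝ) (κ : Fin n → ℝ)
    (hH : H.PosDef) (hX : IsUnit X) (hG : G * X = X * diagonal κ)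
    (hO : Oᵀ * O = 1) (hGO : Gᵀ * G = Oᵀ * H * O) :
    (∏ i, κ (Fin.castLE hk i)) ^ 2 ≤ ∏ i, eigsDesc H (Fin.castLE hk i) := by
  let Y : Matrix (Fin n) (Fin k) ℝ := X.submatrix id (Fin.castLE hk)
  let L : Matrix (Fin k) (Fin k) ℝ := diagonal fun i => κ (Fin.castLE hk i)
  have hY : G * Y = Y * L := by
    ext i j
    have := congrFun (congrFun hG i) (Fin.castLE hk j)
    rw [Matrix.mul_diagonal] at this
    rw [Matrix.mul_diagonal]
    exact this
  have hpos : 0 < (Yᵀ * Y).det := by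
    have : (Yᴴ * Y).PosDef := by
      apply Matrix.PosDef.conjTranspose_mul_self
      have hl : LinearIndependent ℝ X.col := Matrix.linearIndependent_cols_of_isUnit hX
      rw [Matrix.mulVec_injective_iff]
      exact hl.comp (Fin.castLE hk) (Fin.castLE_injective hk)
    rw [Matrix.conjTranspose_eq_transpose_of_trivial] at this
    exact this.det_pos
  have h1 := det_le_top hk hH (O * Y)
  have e1 : (O * Y)ᵀ * H * (O * Y) = L * (Yᵀ * Y) * L := by
    calc (O * Y)ᵀ * H * (O * Y) = Yᵀ * (Oᵀ * H * O) * Y := by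
          simp only [Matrix.transpose_mul, Matrix.mul_assoc]
      _ = (G * Y)ᵀ * (G * Y) := by
          rw [← hGO]; simp only [Matrix.transpose_mul, Matrix.mul_assoc]
      _ = _ := by
          rw [hY]; simp only [L, Matrix.transpose_mul, Matrix.mul_assoc, Matrix.diagonal_transpose]
  have e2 : (O * Y)ᵀ * (O * Y) = Yᵀ * Y := by
    rw [Matrix.transpose_mul, Matrix.mul_assoc, ← Matrix.mul_assoc Oᵀ, hO, Matrix.one_mul]
  rw [e1, e2, Matrix.det_mul, Matrix.det_mul] at h1
  have e3 : L.det = ∏ i, κ (Fin.castLE hk i) := Matrix.det_diagonal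
  rw [e3] at h1
  refine le_of_mul_le_mul_right ?_ hpos
  calc _ = _ := by ring
    _ ≤ _ := h1

lemma weyl_eq {n : ℕ} (G X O H : Matrix (Fin n) (Fin n) ℝ) (κ : Fin n → ℝ)
    (hH : H.PosDef) (hX : IsUnit X) (hG : G * X = X * diagonal κ)
    (hO : Oᵀ * O = 1) (hGO : Gᵀ * G = Oᵀ * H * O) :
    (∏ i, κ i) ^ 2 = ∏ i, eigsDesc H i := by
  obtain ⟨-, U, hU, hU', hs⟩ := eigsDesc_spec hH.1
  have a1 := congrArg Matrix.det hG
  have a2 := congrArg Matrix.det hGO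
  have a3 := congrArg Matrix.det hO
  have a4 := congrArg Matrix.det hs
  have a5 := congrArg Matrix.det hU
  simp only [Matrix.det_mul, Matrix.det_transpose, Matrix.det_diagonal, Matrix.det_one] at a1 a2 a3 a4 a5
  have hx : X.det ≠ 0 := ((Matrix.isUnit_iff_isUnit_det X).mp hX).ne_zero
  have a6 : G.det = ∏ i, κ i := mul_right_cancel₀ hx (by rw [a1]; ring)
  rw [← a6]
  calc G.det ^ 2 = G.det * G.det := by ring
    _ = (O.det * O.det) * H.det := by rw [a2]; ring
    _ = (U.det * U.det) * ∏ i, eigsDesc H i := by rw [a3, a4]; ring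
    _ = _ := by rw [a5, one_mul]

lemma psum_castLE {n k : ℕ} (hk : k ≤ n) (ξ : Fin n → ℝ) :
    psum ξ k = ∑ i, ξ (Fin.castLE hk i) := by
  rw [psum]
  have : Finset.univ.filter (fun i : Fin n => (i : ℕ) < k) =
      Finset.univ.map (Fin.castLEEmb hk) := by
    ext i
    simp only [Finset.mem_filter, Finset.mem_univ, true_and, Finset.mem_map]
    constructor
    · intro h; exact ⟨⟨i, h⟩, rfl⟩
    · rintro ⟨j, rfl⟩; exact j.2
  rw [this, Finset.sum_map]
  rfl

lemma gram_posDef {n : ℕ} {p q : Matrix (Fin n) (Fin n) ℝ} (hp : p.PosDef) (hq : q.PosDef)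
    (s t : ℝ) : ((mpow p s * mpow q t)ᵀ * (mpow p s * mpow q t)).PosDef := by
  rw [← Matrix.conjTranspose_eq_transpose_of_trivial]
  exact Matrix.PosDef.conjTranspose_mul_self _ (Matrix.mulVec_injective_of_isUnit
    ((mpow_posDef hp s).isUnit.mul (mpow_posDef hq t).isUnit))

lemma vecd_eq {n : ℕ} {p q : Matrix (Fin n) (Fin n) ℝ} (hp : p.PosDef) (hq : q.PosDef)
    (i : Fin n) : vecd p q i = Real.logb 2 (eigsDesc ((mpow p (-(1/2)) * mpow q (1/2))ᵀ *
      (mpow p (-(1/2)) * mpow q (1/2))) i) := by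
  have := eigsDesc_pos (gram_posDef hp hq (-(1/2)) (1/2)) i
  rw [vecd, sigmaVec, svals, Real.logb, Real.logb, Real.log_sqrt this.le]
  ring

lemma psum_vecd {n k : ℕ} (hk : k ≤ n) {p q : Matrix (Fin n) (Fin n) ℝ} (hp : p.PosDef)
    (hq : q.PosDef) : psum (vecd p q) k = Real.logb 2 (∏ i,
      eigsDesc ((mpow p (-(1/2)) * mpow q (1/2))ᵀ *
      (mpow p (-(1/2)) * mpow q (1/2))) (Fin.castLE hk i)) := by
  rw [psum_castLE hk, Real.logb_prod]
  · exact Finset.sum_congr rfl fun i _ => vecd_eq hp hq _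
  · exact fun i _ => (eigsDesc_pos (gram_posDef hp hq _ _) _).ne'

lemma psum_half {n k : ℕ} (ξ : Fin n → ℝ) :
    psum (fun i => (1/2) * ξ i) k = (1/2) * psum ξ k := by
  rw [psum, psum, Finset.mul_sum]

lemma geo_posDef {n : ℕ} {r p : Matrix (Fin n) (Fin n) ℝ} (hr : r.PosDef) (hp : p.PosDef) :
    (mpow r (-(1/2)) * p * mpow r (-(1/2))).PosDef ∧ (geo r p (1/2)).PosDef := by
  have h1 : (mpow r (-(1/2)) * p * mpow r (-(1/2))).PosDef :=
    congr_posDef hp ((mpow_spec hr).1 _) (mpow_posDef hr _).isUnit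
  exact ⟨h1, congr_posDef (mpow_posDef h1 _) ((mpow_spec hr).1 _) (mpow_posDef hr _).isUnit⟩

lemma half_facts {n : ℕ} {p : Matrix (Fin n) (Fin n) ℝ} (hp : p.PosDef) :
    (mpow p (1/2))ᵀ = mpow p (1/2) ∧ (mpow p (-(1/2)))ᵀ = mpow p (-(1/2)) ∧
    mpow p (1/2) * mpow p (1/2) = p ∧ mpow p (1/2) * mpow p (-(1/2)) = 1 ∧
    mpow p (-(1/2)) * mpow p (1/2) = 1 := by
  obtain ⟨h1, h2, h3, h4⟩ := mpow_spec hp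
  refine ⟨h1 _, h1 _, ?_, ?_, ?_⟩
  · rw [h2]; norm_num; exact h4
  · rw [h2]; norm_num; exact h3
  · rw [h2]; norm_num; exact h3

lemma setup {n : ℕ} (p q r : Matrix (Fin n) (Fin n) ℝ)
    (hp : p.PosDef) (hq : q.PosDef) (hr : r.PosDef) (K : Matrix (Fin n) (Fin n) ℝ)
    (hK : K = (mpow (geo r p (1/2)) (-(1/2)) * mpow (geo r q (1/2)) (1/2))ᵀ *
      (mpow (geo r p (1/2)) (-(1/2)) * mpow (geo r q (1/2)) (1/2))) :
    ∃ G X O : Matrix (Fin n) (Fin n) ℝ, IsUnit X ∧ G * X = X * diagonal (eigsDesc K) ∧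
      Oᵀ * O = 1 ∧ Gᵀ * G = Oᵀ * ((mpow p (-(1/2)) * mpow q (1/2))ᵀ *
      (mpow p (-(1/2)) * mpow q (1/2))) * O := by
  obtain ⟨ha, hm1⟩ := geo_posDef hr hp
  obtain ⟨hb, hm2⟩ := geo_posDef hr hq
  have hKp : K.PosDef := hK ▸ gram_posDef hm1 hm2 _ _
  obtain ⟨-, U, hU, hU', hs⟩ := eigsDesc_spec hKp.1
  obtain ⟨r1, r2, r3, r4, r5⟩ := half_facts hr
  obtain ⟨p1, p2, p3, p4, p5⟩ := half_facts hp
  obtain ⟨q1, q2, q3, q4, q5⟩ := half_facts hq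
  obtain ⟨a1, a2, a3, a4, a5⟩ := half_facts ha
  obtain ⟨b1, b2, b3, b4, b5⟩ := half_facts hb
  obtain ⟨m1, m2, m3, m4, m5⟩ := half_facts hm1
  obtain ⟨k1, k2, k3, k4, k5⟩ := half_facts hm2
  have hg1 : geo r p (1/2) = mpow r (1/2) *
    mpow (mpow r (-(1/2)) * p * mpow r (-(1/2))) (1/2) * mpow r (1/2) := rfl
  have hg2 : geo r q (1/2) = mpow r (1/2) *
    mpow (mpow r (-(1/2)) * q * mpow r (-(1/2))) (1/2) * mpow r (1/2) := rfl
  generalize mpow (geo r p (1/2)) (1/2) = Mh at *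
  generalize mpow (geo r p (1/2)) (-(1/2)) = Mi at *
  generalize mpow (geo r q (1/2)) (1/2) = Nh at *
  generalize mpow (geo r q (1/2)) (-(1/2)) = Ni at *
  generalize geo r p (1/2) = M at *
  generalize geo r q (1/2) = N at *
  generalize mpow (mpow r (-(1/2)) * p * mpow r (-(1/2))) (1/2) = S at *
  generalize mpow (mpow r (-(1/2)) * p * mpow r (-(1/2))) (-(1/2)) = Si at *
  generalize mpow (mpow r (-(1/2)) * q * mpow r (-(1/2))) (1/2) = T at *
  generalize mpow (mpow r (-(1/2)) * q * mpow r (-(1/2))) (-(1/2)) = Ti at *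
  generalize mpow r (1/2) = R at *
  generalize mpow r (-(1/2)) = Ri at *
  generalize mpow p (1/2) = Ph at *
  generalize mpow p (-(1/2)) = Pi at *
  generalize mpow q (1/2) = Qh at *
  generalize mpow q (-(1/2)) = Qi at *
  -- `Mi * Mi` is the inverse of `M`
  have hMM : Mi * Mi = Ri * Si * Ri := by
    have e1 : (Mi * Mi) * M = 1 := by
      rw [← m3, Matrix.mul_assoc, ← Matrix.mul_assoc Mi Mh, m5, Matrix.one_mul, m5]
    have e2 : M * (Ri * Si * Ri) = 1 := by
      rw [hg1]
      calc R * S * R * (Ri * Si * Ri) = R * S * (R * Ri) * Si * Ri := by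
            simp only [Matrix.mul_assoc]
        _ = R * (S * Si) * Ri := by rw [r4]; simp only [Matrix.mul_assoc, Matrix.mul_one]
        _ = 1 := by rw [a4, Matrix.mul_one, r4]
    exact left_inv_eq_right_inv e1 e2
  have hSS : Si * Si = R * (Pi * Pi) * R := by
    have e1 : (Si * Si) * (S * S) = 1 := by
      rw [Matrix.mul_assoc, ← Matrix.mul_assoc Si S, a5, Matrix.one_mul, a5]
    have e2 : (S * S) * (R * (Pi * Pi) * R) = 1 := by
      rw [a3, ← p3]
      calc Ri * (Ph * Ph) * Ri * (R * (Pi * Pi) * R)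
          = Ri * Ph * Ph * (Ri * R) * Pi * Pi * R := by simp only [Matrix.mul_assoc]
        _ = Ri * Ph * (Ph * Pi) * Pi * R := by
            rw [r5]; simp only [Matrix.mul_assoc, Matrix.one_mul]
        _ = Ri * (Ph * Pi) * R := by 
            rw [p4, Matrix.mul_one, Matrix.mul_one, Matrix.mul_assoc Ri Ph Pi, p4, Matrix.mul_one]
        _ = 1 := by rw [p4, Matrix.mul_one, r5]
    exact left_inv_eq_right_inv e1 e2
  have hQQ : R * (Qi * Qi) * R = Ti * Ti := by
    have e1 : (Ti * Ti) * (T * T) = 1 := by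
      rw [Matrix.mul_assoc, ← Matrix.mul_assoc Ti T, b5, Matrix.one_mul, b5]
    have e2 : (T * T) * (R * (Qi * Qi) * R) = 1 := by
      rw [b3, ← q3]
      calc Ri * (Qh * Qh) * Ri * (R * (Qi * Qi) * R)
          = Ri * Qh * Qh * (Ri * R) * Qi * Qi * R := by simp only [Matrix.mul_assoc]
        _ = Ri * Qh * (Qh * Qi) * Qi * R := by
            rw [r5]; simp only [Matrix.mul_assoc, Matrix.one_mul]
        _ = Ri * (Qh * Qi) * R := by 
            rw [q4, Matrix.mul_one, Matrix.mul_one, Matrix.mul_assoc Ri Qh Qi, q4, Matrix.mul_one]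
        _ = 1 := by rw [q4, Matrix.mul_one, r5]
    exact (left_inv_eq_right_inv e1 e2).symm
  refine ⟨Si * T, R * Ni * U, Qi * R * T, ?_, ?_, ?_, ?_⟩
  · exact ((IsUnit.of_mul_eq_one _ r4).mul (IsUnit.of_mul_eq_one _ k5)).mul
      (IsUnit.of_mul_eq_one _ hU')
  · have hKU : K * U = U * diagonal (eigsDesc K) := by
      conv_lhs => rw [hs]
      rw [Matrix.mul_assoc, hU, Matrix.mul_one]
    have e1 : Si * T * R = R * (Mi * Mi) * (Nh * Nh) := by
      rw [hMM, k3, hg2]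
      calc Si * T * R = (R * Ri) * Si * (Ri * R) * T * R := by
            rw [r4, r5]; simp only [Matrix.mul_one, Matrix.one_mul]
        _ = _ := by simp only [Matrix.mul_assoc]
    have e2 : Si * T * R * Ni = R * Ni * K := by
      rw [e1, hK, Matrix.transpose_mul, m2, k1]
      calc R * (Mi * Mi) * (Nh * Nh) * Ni = R * Mi * Mi * Nh * (Nh * Ni) := by
            simp only [Matrix.mul_assoc]
        _ = R * (Ni * Nh) * Mi * Mi * Nh := by rw [k4, k5]; simp only [Matrix.mul_one]
        _ = _ := by simp only [Matrix.mul_assoc]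
    calc Si * T * (R * Ni * U) = (Si * T * R * Ni) * U := by simp only [Matrix.mul_assoc]
      _ = R * Ni * (K * U) := by rw [e2, Matrix.mul_assoc]
      _ = _ := by rw [hKU]; simp only [Matrix.mul_assoc]
  · simp only [Matrix.transpose_mul, q2, r1, b1]
    calc T * (R * Qi) * (Qi * R * T) = T * (R * (Qi * Qi) * R) * T := by
          simp only [Matrix.mul_assoc]
      _ = (T * Ti) * (Ti * T) := by rw [hQQ]; simp only [Matrix.mul_assoc]
      _ = 1 := by rw [b4, b5, Matrix.one_mul]
  · simp only [Matrix.transpose_mul, q2, r1, b1, a2, p2, q1]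
    calc T * Si * (Si * T) = T * (Si * Si) * T := by simp only [Matrix.mul_assoc]
      _ = T * R * Pi * Pi * R * T := by rw [hSS]; simp only [Matrix.mul_assoc]
      _ = T * R * (Qi * Qh) * Pi * Pi * (Qh * Qi) * R * T := by
          rw [q4, q5]; simp only [Matrix.mul_one]
      _ = _ := by simp only [Matrix.mul_assoc]

/-- The geodesic midpoint map contracts the vectorial distance by `1/2`:
`d⃗(r #_{1/2} p, r #_{1/2} q) ⪯ (1/2) d⃗(p,q)`. -/
theorem statement9 {n : ℕ} (p q r : Matrix (Fin n) (Fin n) ℝ)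
    (hp : p.PosDef) (hq : q.PosDef) (hr : r.PosDef) :
    maj (vecd (geo r p (1/2)) (geo r q (1/2))) (fun i => (1/2) * vecd p q i) := by
  obtain ⟨-, hm1⟩ := geo_posDef hr hp
  obtain ⟨-, hm2⟩ := geo_posDef hr hq
  obtain ⟨G, X, O, hX, hG, hO, hGO⟩ := setup p q r hp hq hr _ rfl
  have hH := gram_posDef hp hq (-(1/2)) (1/2)
  have hKp := eigsDesc_pos (gram_posDef hm1 hm2 (-(1/2)) (1/2))
  have half : ∀ x : ℝ, Real.logb 2 x = (1/2) * Real.logb 2 (x ^ 2) := by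
    intro x
    rw [Real.logb_pow]; push_cast; ring
  constructor
  · intro k hk
    rw [psum_half, psum_vecd hk.le hm1 hm2, psum_vecd hk.le hp hq, half]
    refine mul_le_mul_of_nonneg_left ?_ (by norm_num)
    refine Real.logb_le_logb_of_le (by norm_num) (pow_pos (Finset.prod_pos fun i _ => hKp _) 2) ?_
    exact weyl hk.le G X O _ _ hH hX hG hO hGO
  · rw [psum_half, psum_vecd le_rfl hm1 hm2, psum_vecd le_rfl hp hq, half]
    congr 2
    exact weyl_eq G X O _ _ hH hX hG hO hGO
end
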